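/- arXiv:1911.12892 — 2 statements merged into one kernel-verified Lean document; each statement's English description precedes it below -/
import Mathlib

section
/- Suppose θ0 = π/4, θ1 ∈ (π/2, 3π/4), and c > 0 with c² < (π/5) cot(19π/40) · (1 + (π/40) cot(19π/40))^{−1} (the parameters of Shih's example). Let λ, Λ ∈ ℝ admit twice continuously differentiable positive Dirichlet solutions: h1 > 0 on (θ0,θ1), h1(θ0) = h1(θ1) = 0, h1'' + (λ (csc θ)² − c²) h1 = 0; and h2 > 0 on (θ0,θ1), h2(θ0) = h2(θ1) = 0, h2'' + (Λ (csc θ)² − 4c²) h2 = 0. Then Λ − λ > 3π²/(2D²), where D = D_{c,θ0,θ1} is the hyperbolic diameter of Ω_{c,θ0,θ1}. -/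
open Real Set

/-- Hyperbolic distance in the Poincaré upper half-plane:
`cosh (dist p q) = 1 + ((x₂-x₁)² + (y₂-y₁)²)/(2 y₁ y₂)`. -/
noncomputable def hDist (p q : ℝ × ℝ) : ℝ :=
  Real.log ((1 + ((q.1 - p.1) ^ 2 + (q.2 - p.2) ^ 2) / (2 * p.2 * q.2)) +
    Real.sqrt ((1 + ((q.1 - p.1) ^ 2 + (q.2 - p.2) ^ 2) / (2 * p.2 * q.2)) ^ 2 - 1))

/-- Diameter of a set with respect to the hyperbolic distance. -/
noncomputable def hDiam (S : Set (ℝ × ℝ)) : ℝ :=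
  sSup {d : ℝ | ∃ p ∈ S, ∃ q ∈ S, d = hDist p q}

/-- The domain `Ω_{c,θ0,θ1}` in polar coordinates. -/
def Omega (c θ0 θ1 : ℝ) : Set (ℝ × ℝ) :=
  {p | ∃ r θ : ℝ, 1 < r ∧ r < Real.exp (π / c) ∧ θ0 < θ ∧ θ < θ1 ∧
    p = (r * Real.cos θ, r * Real.sin θ)}

/-- On a segment of the imaginary axis the hyperbolic distance is the logarithm of the ratio of
the heights. -/
lemma hDist_vertical {a b : ℝ} (ha : 0 < a) (hab : a ≤ b) :
    hDist (0, a) (0, b) = Real.log (b / a) := by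
  have hb : 0 < b := ha.trans_le hab
  have hsq : (1 + ((0 - 0 : ℝ) ^ 2 + (b - a) ^ 2) / (2 * a * b)) ^ 2 - 1
      = ((b ^ 2 - a ^ 2) / (2 * a * b)) ^ 2 := by
    field_simp
    ring
  have hnonneg : 0 ≤ (b ^ 2 - a ^ 2) / (2 * a * b) :=
    div_nonneg (by nlinarith) (by positivity)
  simp only [hDist]
  rw [hsq, Real.sqrt_sq hnonneg]
  congr 1
  field_simp
  ring

lemma half_lt_sin_sq {θ : ℝ} (h₀ : π / 4 < θ) (h₁ : θ < 3 * π / 4) : 1 / 2 < Real.sin θ ^ 2 := by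
  have hcos : Real.cos (2 * θ) < 0 :=
    Real.cos_neg_of_pi_div_two_lt_of_lt (by linarith) (by linarith [Real.pi_pos])
  nlinarith [Real.cos_sq θ, Real.sin_sq_add_cos_sq θ]

lemma bddAbove_hDist_Omega {c θ1 : ℝ} (hθ1 : θ1 < 3 * π / 4) :
    BddAbove {d : ℝ | ∃ p ∈ Omega c (π / 4) θ1, ∃ q ∈ Omega c (π / 4) θ1, d = hDist p q} := by
  set R := Real.exp (π / c)
  have hcoord : ∀ p ∈ Omega c (π / 4) θ1,
      1 / 2 < p.2 ∧ p.1 ^ 2 + p.2 ^ 2 ≤ R ^ 2 := by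
    rintro p ⟨r, θ, hr, hrR, h₀, h₁, rfl⟩
    have hsin : 0 < Real.sin θ :=
      Real.sin_pos_of_pos_of_lt_pi (by linarith [Real.pi_pos]) (by linarith [Real.pi_pos])
    have hsq := half_lt_sin_sq h₀ (h₁.trans hθ1)
    have hle := Real.sin_le_one θ
    refine ⟨?_, ?_⟩
    · change 1 / 2 < r * Real.sin θ
      nlinarith
    · change (r * Real.cos θ) ^ 2 + (r * Real.sin θ) ^ 2 ≤ R ^ 2
      have : (r * Real.cos θ) ^ 2 + (r * Real.sin θ) ^ 2 = r ^ 2 := by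
        rw [mul_pow, mul_pow, ← mul_add, Real.cos_sq_add_sin_sq, mul_one]
      rw [this]
      gcongr
  refine ⟨2 * (1 + 8 * R ^ 2), ?_⟩
  rintro d ⟨p, hp, q, hq, rfl⟩
  obtain ⟨hp₂, hpR⟩ := hcoord p hp
  obtain ⟨hq₂, hqR⟩ := hcoord q hq
  have hden : 1 / 2 ≤ 2 * p.2 * q.2 := by nlinarith
  have hnum : (q.1 - p.1) ^ 2 + (q.2 - p.2) ^ 2 ≤ 4 * R ^ 2 := by
    nlinarith [sq_nonneg (q.1 + p.1), sq_nonneg (q.2 + p.2)]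
  have hquot : ((q.1 - p.1) ^ 2 + (q.2 - p.2) ^ 2) / (2 * p.2 * q.2) ≤ 8 * R ^ 2 := by
    rw [div_le_iff₀ (by linarith)]
    nlinarith [sq_nonneg R]
  have hquot₀ : 0 ≤ ((q.1 - p.1) ^ 2 + (q.2 - p.2) ^ 2) / (2 * p.2 * q.2) :=
    div_nonneg (by positivity) (by linarith)
  unfold hDist
  set A := 1 + ((q.1 - p.1) ^ 2 + (q.2 - p.2) ^ 2) / (2 * p.2 * q.2)
  have hsqrt : Real.sqrt (A ^ 2 - 1) ≤ A := Real.sqrt_le_iff.2 ⟨by linarith, by linarith⟩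
  calc Real.log (A + Real.sqrt (A ^ 2 - 1)) ≤ A + Real.sqrt (A ^ 2 - 1) :=
        Real.log_le_self (by positivity)
    _ ≤ 2 * (1 + 8 * R ^ 2) := by linarith

lemma pi_div_le_hDiam_Omega {c θ1 : ℝ} (hc : 0 < c) (hθ1 : θ1 ∈ Ioo (π / 2) (3 * π / 4)) :
    π / c ≤ hDiam (Omega c (π / 4) θ1) := by
  have hL : 0 < π / c := div_pos Real.pi_pos hc
  have hmem : ∀ t, 0 < t → t < π / c → ((0 : ℝ), Real.exp t) ∈ Omega c (π / 4) θ1 := fun t h₀ h₁ =>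
    ⟨Real.exp t, π / 2, Real.one_lt_exp_iff.2 h₀, Real.exp_lt_exp.2 h₁,
      by linarith [Real.pi_pos], hθ1.1, by simp⟩
  refine le_of_forall_lt fun x hx => ?_
  obtain ⟨s, hs₀, hs₁, hs₂⟩ : ∃ s, 0 < s ∧ 2 * s < π / c ∧ x < π / c - 2 * s := by
    have hmin : 0 < min (π / c - x) (π / c) := lt_min (by linarith) hL
    have h₁ := min_le_left (π / c - x) (π / c)
    have h₂ := min_le_right (π / c - x) (π / c)
    exact ⟨min (π / c - x) (π / c) / 4, by linarith, by linarith, by linarith⟩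
  refine hs₂.trans_le (le_csSup (bddAbove_hDist_Omega hθ1.2)
    ⟨_, hmem s hs₀ (by linarith), _, hmem (π / c - s) (by linarith) (by linarith), ?_⟩)
  rw [hDist_vertical (Real.exp_pos _) (Real.exp_le_exp.2 (by linarith)), ← Real.exp_sub,
    Real.log_exp]
  ring

/-- Sturm comparison through the Wronskian of two positive Dirichlet solutions: the difference of
the potentials cannot be positive throughout the interval. -/
lemma exists_potential_le_of_dirichlet {a b : ℝ} (hab : a < b) {V W f g : ℝ → ℝ}
    (hf : ContDiff ℝ 2 f) (hg : ContDiff ℝ 2 g)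
    (hfpos : ∀ x ∈ Ioo a b, 0 < f x) (hgpos : ∀ x ∈ Ioo a b, 0 < g x)
    (hfa : f a = 0) (hfb : f b = 0) (hga : g a = 0) (hgb : g b = 0)
    (hode_f : ∀ x ∈ Icc a b, deriv (deriv f) x + V x * f x = 0)
    (hode_g : ∀ x ∈ Icc a b, deriv (deriv g) x + W x * g x = 0) :
    ∃ x ∈ Ioo a b, V x ≤ W x := by
  by_contra! hlt
  have hdf : Differentiable ℝ f := hf.differentiable (by norm_num)
  have hdg : Differentiable ℝ g := hg.differentiable (by norm_num)
  have hdf' : Differentiable ℝ (deriv f) :=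
    (contDiff_succ_iff_deriv.1 (show ContDiff ℝ (1 + 1) f from hf)).2.2.differentiable (by norm_num)
  have hdg' : Differentiable ℝ (deriv g) :=
    (contDiff_succ_iff_deriv.1 (show ContDiff ℝ (1 + 1) g from hg)).2.2.differentiable (by norm_num)
  have hderiv : ∀ x, HasDerivAt (fun y => f y * deriv g y - g y * deriv f y)
      (f x * deriv (deriv g) x - g x * deriv (deriv f) x) x := fun x => by
    have h := ((hdf x).hasDerivAt.mul (hdg' x).hasDerivAt).sub
      ((hdg x).hasDerivAt.mul (hdf' x).hasDerivAt)
    exact h.congr_deriv (by ring)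
  have hmono : StrictMonoOn (fun y => f y * deriv g y - g y * deriv f y) (Icc a b) := by
    refine strictMonoOn_of_deriv_pos (convex_Icc a b)
      (fun x _ => (hderiv x).continuousAt.continuousWithinAt) fun x hx => ?_
    rw [interior_Icc] at hx
    have hx' := Ioo_subset_Icc_self hx
    rw [(hderiv x).deriv, eq_neg_of_add_eq_zero_left (hode_f x hx'),
      eq_neg_of_add_eq_zero_left (hode_g x hx')]
    have := mul_pos (mul_pos (hfpos x hx) (hgpos x hx)) (sub_pos.2 (hlt x hx))
    linarith
  have := hmono (left_mem_Icc.2 hab.le) (right_mem_Icc.2 hab.le) hab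
  simp [hfa, hfb, hga, hgb] at this

theorem shih_example_gap_estimate
    (θ0 θ1 : ℝ) (hθ0 : θ0 = π / 4) (hθ1 : θ1 ∈ Ioo (π / 2) (3 * π / 4))
    (c : ℝ) (hc : 0 < c)
    (hcbound : c ^ 2 < π / 5 * Real.cos (19 * π / 40) / Real.sin (19 * π / 40) *
      (1 + π / 40 * (Real.cos (19 * π / 40) / Real.sin (19 * π / 40)))⁻¹)
    (lam Lam : ℝ)
    (h1 h2 : ℝ → ℝ) (hC1 : ContDiff ℝ 2 h1) (hC2 : ContDiff ℝ 2 h2)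
    (hpos1 : ∀ θ ∈ Ioo θ0 θ1, 0 < h1 θ) (hpos2 : ∀ θ ∈ Ioo θ0 θ1, 0 < h2 θ)
    (hb10 : h1 θ0 = 0) (hb11 : h1 θ1 = 0) (hb20 : h2 θ0 = 0) (hb21 : h2 θ1 = 0)
    (hode1 : ∀ θ ∈ Icc θ0 θ1,
      deriv (deriv h1) θ + (lam * ((Real.sin θ)⁻¹) ^ 2 - c ^ 2) * h1 θ = 0)
    (hode2 : ∀ θ ∈ Icc θ0 θ1,
      deriv (deriv h2) θ + (Lam * ((Real.sin θ)⁻¹) ^ 2 - 4 * c ^ 2) * h2 θ = 0) :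
    Lam - lam > 3 * π ^ 2 / (2 * (hDiam (Omega c θ0 θ1)) ^ 2) := by
  subst hθ0
  have hgap : 3 * c ^ 2 / 2 < Lam - lam := by
    obtain ⟨x, hx, hle⟩ := exists_potential_le_of_dirichlet
      (show π / 4 < θ1 by linarith [hθ1.1, Real.pi_pos]) hC1 hC2 hpos1 hpos2
      hb10 hb11 hb20 hb21 hode1 hode2
    have hsin := half_lt_sin_sq hx.1 (hx.2.trans hθ1.2)
    have hsin₀ : 0 < Real.sin x ^ 2 := by linarith
    rw [inv_pow] at hle
    have hmul : 3 * c ^ 2 * Real.sin x ^ 2 ≤ Lam - lam := by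
      rw [← le_div_iff₀ hsin₀, div_eq_mul_inv]
      linarith
    nlinarith [pow_pos hc 2]
  have hdiam := pi_div_le_hDiam_Omega hc hθ1
  set D := hDiam (Omega c (π / 4) θ1)
  have hD : 0 < D := (div_pos Real.pi_pos hc).trans_le hdiam
  have hpi : π ≤ D * c := (div_le_iff₀ hc).1 hdiam
  have hsq : π ^ 2 ≤ (D * c) ^ 2 := by gcongr
  refine lt_of_le_of_lt ?_ hgap
  rw [div_le_iff₀ (by positivity)]
  linarith
end

section
/- (Sturm comparison theorem I) For i = 1, 2, let x_i > 0, let b_i : [0, x_i] → ℝ be continuous, and let f_i : [0, x_i] → ℝ be twice continuously differentiable with f_i > 0 on (0, x_i), f_i(0) = 0, f_i(x_i) = 0, satisfying f_i'' + b_i f_i = 0. Suppose b_1(x) ≥ b_2(x) for all x in the common domain. Then x_1 ≤ x_2; and if x_1 = x_2, then b_1 ≡ b_2 on [0, x_1]. -/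
/-- The Wronskian of two twice continuously differentiable functions `f`, `g` has
derivative `f g'' - f'' g`. -/
theorem hasDerivAt_wronskian {f g : ℝ → ℝ} (hf : ContDiff ℝ 2 f) (hg : ContDiff ℝ 2 g) (x : ℝ) :
    HasDerivAt (fun t => f t * deriv g t - deriv f t * g t)
      (f x * deriv (deriv g) x - deriv (deriv f) x * g x) x := by
  have hf' : HasDerivAt f (deriv f x) x :=
    (hf.differentiable (by norm_num) x).hasDerivAt
  have hg' : HasDerivAt g (deriv g x) x :=
    (hg.differentiable (by norm_num) x).hasDerivAt
  have hf'' : HasDerivAt (deriv f) (deriv (deriv f) x) x :=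
    ((hf.deriv' (n := 1)).differentiable (by norm_num) x).hasDerivAt
  have hg'' : HasDerivAt (deriv g) (deriv (deriv g) x) x :=
    ((hg.deriv' (n := 1)).differentiable (by norm_num) x).hasDerivAt
  exact ((hf'.mul hg'').sub (hf''.mul hg')).congr_deriv (by ring)

open Set

theorem sturm_comparison_I
    (x1 x2 : ℝ) (hx1 : 0 < x1) (hx2 : 0 < x2)
    (b1 b2 : ℝ → ℝ)
    (hb1c : ContinuousOn b1 (Icc 0 x1)) (hb2c : ContinuousOn b2 (Icc 0 x2))
    (f1 f2 : ℝ → ℝ) (hf1 : ContDiff ℝ 2 f1) (hf2 : ContDiff ℝ 2 f2)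
    (hf1pos : ∀ x ∈ Ioo 0 x1, 0 < f1 x) (hf2pos : ∀ x ∈ Ioo 0 x2, 0 < f2 x)
    (hf10 : f1 0 = 0) (hf1x : f1 x1 = 0)
    (hf20 : f2 0 = 0) (hf2x : f2 x2 = 0)
    (hode1 : ∀ x ∈ Icc 0 x1, deriv (deriv f1) x + b1 x * f1 x = 0)
    (hode2 : ∀ x ∈ Icc 0 x2, deriv (deriv f2) x + b2 x * f2 x = 0)
    (hb : ∀ x ∈ Icc 0 (min x1 x2), b2 x ≤ b1 x) :
    x1 ≤ x2 ∧ (x1 = x2 → ∀ x ∈ Icc 0 x1, b1 x = b2 x) := by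
  set W : ℝ → ℝ := fun t => f1 t * deriv f2 t - deriv f1 t * f2 t with hW
  have hWd : ∀ x ∈ Ioo 0 (min x1 x2), HasDerivAt W ((b1 x - b2 x) * (f1 x * f2 x)) x := by
    intro x hx
    obtain ⟨h0, h1, h2⟩ : 0 < x ∧ x < x1 ∧ x < x2 := ⟨hx.1, lt_min_iff.1 hx.2⟩
    refine (hasDerivAt_wronskian hf1 hf2 x).congr_deriv ?_
    linear_combination f1 x * hode2 x ⟨h0.le, h2.le⟩ - f2 x * hode1 x ⟨h0.le, h1.le⟩
  have hWc : Continuous W :=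
    continuous_iff_continuousAt.2 fun x => (hasDerivAt_wronskian hf1 hf2 x).continuousAt
  have hWm : MonotoneOn W (Icc 0 (min x1 x2)) := by
    refine monotoneOn_of_deriv_nonneg (convex_Icc _ _) hWc.continuousOn
      (fun x _ => (hasDerivAt_wronskian hf1 hf2 x).differentiableAt.differentiableWithinAt) ?_
    intro x hx
    rw [interior_Icc] at hx
    rw [(hWd x hx).deriv]
    have h12 := lt_min_iff.1 hx.2
    exact mul_nonneg (sub_nonneg.2 (hb x (Ioo_subset_Icc_self hx)))
      (mul_pos (hf1pos x ⟨hx.1, h12.1⟩) (hf2pos x ⟨hx.1, h12.2⟩)).le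
  have hm : 0 < min x1 x2 := lt_min hx1 hx2
  have hW0 : W 0 = 0 := by simp [hW, hf10, hf20]
  have hWnn : ∀ x ∈ Icc 0 (min x1 x2), 0 ≤ W x := fun x hx =>
    hW0 ▸ hWm (left_mem_Icc.2 hm.le) hx hx.1
  constructor
  · by_contra! hlt
    rw [min_eq_right hlt.le] at hWnn
    have hpos : ∀ x ∈ Ioc 0 x2, 0 < f1 x := fun x hx => hf1pos x ⟨hx.1, hx.2.trans_lt hlt⟩
    have hquot : ∀ x ∈ Ioc 0 x2, HasDerivAt (fun t => f2 t / f1 t) (W x / f1 x ^ 2) x := by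
      intro x hx
      refine ((hf2.differentiable (by norm_num) x).hasDerivAt.div
        (hf1.differentiable (by norm_num) x).hasDerivAt (hpos x hx).ne').congr_deriv ?_
      simp only [hW]
      ring
    have hmono : MonotoneOn (fun t => f2 t / f1 t) (Ioc 0 x2) := by
      refine monotoneOn_of_deriv_nonneg (convex_Ioc _ _)
        (fun x hx => (hquot x hx).continuousAt.continuousWithinAt)
        (fun x hx => (hquot x (interior_subset hx)).differentiableAt.differentiableWithinAt) ?_
      intro x hx
      have hx' := interior_subset hx
      rw [(hquot x hx').deriv]
      exact div_nonneg (hWnn x (Ioc_subset_Icc_self hx')) (sq_nonneg _)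
    have hhalf : x2 / 2 ∈ Ioo 0 x2 := ⟨half_pos hx2, half_lt_self hx2⟩
    have hle := hmono (Ioo_subset_Ioc_self hhalf) (right_mem_Ioc.2 hx2) hhalf.2.le
    simp only [hf2x, zero_div] at hle
    exact hle.not_gt (div_pos (hf2pos _ hhalf) (hpos _ (Ioo_subset_Ioc_self hhalf)))
  · rintro rfl
    rw [min_self] at hWd hWm hWnn
    have hWx : W x1 = 0 := by simp [hW, hf1x, hf2x]
    have hWz : ∀ x ∈ Icc 0 x1, W x = 0 := fun x hx =>
      le_antisymm (hWx ▸ hWm hx (right_mem_Icc.2 hx1.le) hx.2) (hWnn x hx)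
    have heq : EqOn b1 b2 (Ioo 0 x1) := by
      intro x hx
      have hev : W =ᶠ[nhds x] fun _ => 0 := by
        filter_upwards [isOpen_Ioo.mem_nhds hx] with y hy using hWz y (Ioo_subset_Icc_self hy)
      have hz := (hWd x hx).unique ((hasDerivAt_const x (0 : ℝ)).congr_of_eventuallyEq hev)
      exact sub_eq_zero.1 ((mul_eq_zero.1 hz).resolve_right
        (mul_pos (hf1pos x hx) (hf2pos x hx)).ne')
    exact heq.of_subset_closure hb1c hb2c Ioo_subset_Icc_self (closure_Ioo hx1.ne).ge
end
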